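/- arXiv:1806.01905 — 4 statements merged into one kernel-verified Lean document; each statement's English description precedes it below -/
import Mathlib

section
/- There exist real numbers p1 ≥ 0 and p2 ≥ 0 with p1 ≥ (4^Γ1 − 1)·(a21·p2 + I1) and p2 ≥ (4^Γ2 − 1)·(a12·p1 + I2) (i.e., there exists at least one satisfaction equilibrium) if and only if a21·a12 < 1/((4^Γ1 − 1)·(4^Γ2 − 1)). -/
/-- Two-user Gaussian interference channel: there exists at least one
satisfaction equilibrium (a nonnegative profile satisfying both power
inequalities) iff `a21·a12 < 1/((4^Γ1 − 1)·(4^Γ2 − 1))`. -/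
theorem exists_satisfaction_equilibrium_iff
    (a21 a12 I1 I2 Γ1 Γ2 : ℝ)
    (ha21 : 0 < a21) (ha12 : 0 < a12) (hI1 : 0 < I1) (hI2 : 0 < I2)
    (hΓ1 : 0 < Γ1) (hΓ2 : 0 < Γ2) :
    (∃ p1 p2 : ℝ, 0 ≤ p1 ∧ 0 ≤ p2 ∧
        p1 ≥ ((4 : ℝ) ^ Γ1 - 1) * (a21 * p2 + I1) ∧
        p2 ≥ ((4 : ℝ) ^ Γ2 - 1) * (a12 * p1 + I2)) ↔
      a21 * a12 < 1 / (((4 : ℝ) ^ Γ1 - 1) * ((4 : ℝ) ^ Γ2 - 1)) := by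
  have hb : 0 < (4 : ℝ) ^ Γ1 - 1 :=
    sub_pos.mpr (Real.one_lt_rpow (by norm_num) hΓ1)
  have hc : 0 < (4 : ℝ) ^ Γ2 - 1 :=
    sub_pos.mpr (Real.one_lt_rpow (by norm_num) hΓ2)
  generalize (4 : ℝ) ^ Γ1 - 1 = b at *
  generalize (4 : ℝ) ^ Γ2 - 1 = c at *
  rw [lt_div_iff₀ (mul_pos hb hc)]
  constructor
  · rintro ⟨p1, p2, h1, h2, h3, h4⟩
    by_contra! hD
    have e1 := mul_le_mul_of_nonneg_left h4 (mul_pos hb ha21).le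
    have e2 : 0 < b * a21 * c * I2 := by positivity
    have e3 : 0 < b * I1 := by positivity
    have e4 := mul_le_mul_of_nonneg_right hD h1
    nlinarith
  · intro hD
    have hd : 0 < 1 - a21 * a12 * (b * c) := by linarith
    refine ⟨b * (a21 * c * I2 + I1) / (1 - a21 * a12 * (b * c)),
      c * (a12 * b * I1 + I2) / (1 - a21 * a12 * (b * c)),
      by positivity, by positivity, le_of_eq ?_, le_of_eq ?_⟩
    · rw [eq_div_iff hd.ne', mul_assoc, add_mul, mul_assoc a21, div_mul_cancel₀ _ hd.ne']
      ring
    · rw [eq_div_iff hd.ne', mul_assoc, add_mul, mul_assoc a12, div_mul_cancel₀ _ hd.ne']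
      ring
end

section
/- Assume a21·a12 < 1/((4^Γ1 − 1)·(4^Γ2 − 1)) and set D = 1 − (4^Γ1 − 1)·(4^Γ2 − 1)·a21·a12, p1* = (4^Γ1 − 1)·(a21·(4^Γ2 − 1)·I2 + I1)/D and p2* = (4^Γ2 − 1)·(a12·(4^Γ1 − 1)·I1 + I2)/D. Then (p1*, p2*) is a satisfaction equilibrium: p1* ≥ (4^Γ1 − 1)·(a21·p2* + I1) and p2* ≥ (4^Γ2 − 1)·(a12·p1* + I2), with both inequalities holding as equalities. -/
/-- Under `a21·a12 < 1/((4^Γ1 − 1)·(4^Γ2 − 1))`, the profile `(p1*,p2*)` given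
by the closed-form formulas is a satisfaction equilibrium:
`p1* ≥ (4^Γ1 − 1)(a21 p2* + I1)` and `p2* ≥ (4^Γ2 − 1)(a12 p1* + I2)`,
and moreover both inequalities hold as equalities. -/
theorem ese_formula_is_SE_with_equality
    (a21 a12 I1 I2 Γ1 Γ2 D p1s p2s : ℝ)
    (ha21 : 0 < a21) (ha12 : 0 < a12) (hI1 : 0 < I1) (hI2 : 0 < I2)
    (hΓ1 : 0 < Γ1) (hΓ2 : 0 < Γ2)
    (hslope : a21 * a12 < 1 / (((4 : ℝ) ^ Γ1 - 1) * ((4 : ℝ) ^ Γ2 - 1)))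
    (hD : D = 1 - ((4 : ℝ) ^ Γ1 - 1) * ((4 : ℝ) ^ Γ2 - 1) * a21 * a12)
    (hp1s : p1s = ((4 : ℝ) ^ Γ1 - 1) * (a21 * ((4 : ℝ) ^ Γ2 - 1) * I2 + I1) / D)
    (hp2s : p2s = ((4 : ℝ) ^ Γ2 - 1) * (a12 * ((4 : ℝ) ^ Γ1 - 1) * I1 + I2) / D) :
    (p1s ≥ ((4 : ℝ) ^ Γ1 - 1) * (a21 * p2s + I1) ∧
      p2s ≥ ((4 : ℝ) ^ Γ2 - 1) * (a12 * p1s + I2)) ∧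
    (p1s = ((4 : ℝ) ^ Γ1 - 1) * (a21 * p2s + I1) ∧
      p2s = ((4 : ℝ) ^ Γ2 - 1) * (a12 * p1s + I2)) := by
  have h1 : 0 < (4 : ℝ) ^ Γ1 - 1 := by
    have := Real.one_lt_rpow (by norm_num : (1 : ℝ) < 4) hΓ1
    linarith
  have h2 : 0 < (4 : ℝ) ^ Γ2 - 1 := by
    have := Real.one_lt_rpow (by norm_num : (1 : ℝ) < 4) hΓ2
    linarith
  generalize (4 : ℝ) ^ Γ1 - 1 = x at *
  generalize (4 : ℝ) ^ Γ2 - 1 = y at *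
  rw [lt_div_iff₀ (mul_pos h1 h2)] at hslope
  have hD0 : D ≠ 0 := by
    have : 0 < D := by rw [hD]; nlinarith
    exact this.ne'
  have e1 : p1s = x * (a21 * p2s + I1) := by
    rw [hp1s, hp2s]
    field_simp
    rw [hD]
    ring
  have e2 : p2s = y * (a12 * p1s + I2) := by
    rw [hp1s, hp2s]
    field_simp
    rw [hD]
    ring
  exact ⟨⟨e1.ge, e2.ge⟩, e1, e2⟩
end

section
/- The efficient satisfaction equilibrium is unique: if nonnegative profiles (p1,p2) and (q1,q2) are both efficient satisfaction equilibria, then p1 = q1 and p2 = q2. Equivalently, any efficient satisfaction equilibrium satisfies both constraints with equality, and the system p1 = (4^Γ1 − 1)·(a21·p2 + I1), p2 = (4^Γ2 − 1)·(a12·p1 + I2) has at most one solution when a21·a12 < 1/((4^Γ1 − 1)·(4^Γ2 − 1)). -/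
/-- `(p1,p2)` is a satisfaction equilibrium of the two-user Gaussian
interference channel game. -/
def IsSE (a21 a12 I1 I2 Γ1 Γ2 p1 p2 : ℝ) : Prop :=
  0 ≤ p1 ∧ 0 ≤ p2 ∧
  p1 ≥ ((4 : ℝ) ^ Γ1 - 1) * (a21 * p2 + I1) ∧
  p2 ≥ ((4 : ℝ) ^ Γ2 - 1) * (a12 * p1 + I2)

/-- `(p1,p2)` is an efficient satisfaction equilibrium: an SE in which each
user uses the least power satisfying her constraint given the other's power. -/
def IsESE (a21 a12 I1 I2 Γ1 Γ2 p1 p2 : ℝ) : Prop :=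
  IsSE a21 a12 I1 I2 Γ1 Γ2 p1 p2 ∧
  (∀ q1 : ℝ, q1 ≥ ((4 : ℝ) ^ Γ1 - 1) * (a21 * p2 + I1) → p1 ≤ q1) ∧
  (∀ q2 : ℝ, q2 ≥ ((4 : ℝ) ^ Γ2 - 1) * (a12 * p1 + I2) → p2 ≤ q2)

/-- The efficient satisfaction equilibrium is unique: any two ESEs coincide.
Equivalently, any ESE satisfies both constraints with equality, and the
system `p1 = (4^Γ1 − 1)(a21 p2 + I1)`, `p2 = (4^Γ2 − 1)(a12 p1 + I2)` has at
most one solution when `a21·a12 < 1/((4^Γ1 − 1)(4^Γ2 − 1))`. -/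
theorem ese_unique
    (a21 a12 I1 I2 Γ1 Γ2 : ℝ)
    (ha21 : 0 < a21) (ha12 : 0 < a12) (hI1 : 0 < I1) (hI2 : 0 < I2)
    (hΓ1 : 0 < Γ1) (hΓ2 : 0 < Γ2) :
    (∀ p1 p2 q1 q2 : ℝ,
      IsESE a21 a12 I1 I2 Γ1 Γ2 p1 p2 → IsESE a21 a12 I1 I2 Γ1 Γ2 q1 q2 →
      p1 = q1 ∧ p2 = q2) ∧
    (∀ p1 p2 : ℝ, IsESE a21 a12 I1 I2 Γ1 Γ2 p1 p2 →
      p1 = ((4 : ℝ) ^ Γ1 - 1) * (a21 * p2 + I1) ∧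
      p2 = ((4 : ℝ) ^ Γ2 - 1) * (a12 * p1 + I2)) ∧
    (a21 * a12 < 1 / (((4 : ℝ) ^ Γ1 - 1) * ((4 : ℝ) ^ Γ2 - 1)) →
      ∀ p1 p2 q1 q2 : ℝ,
        p1 = ((4 : ℝ) ^ Γ1 - 1) * (a21 * p2 + I1) →
        p2 = ((4 : ℝ) ^ Γ2 - 1) * (a12 * p1 + I2) →
        q1 = ((4 : ℝ) ^ Γ1 - 1) * (a21 * q2 + I1) →
        q2 = ((4 : ℝ) ^ Γ2 - 1) * (a12 * q1 + I2) →
        p1 = q1 ∧ p2 = q2) := by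
  have h1 : 0 < (4 : ℝ) ^ Γ1 - 1 := by
    have := Real.one_lt_rpow (x := 4) (by norm_num) hΓ1
    linarith
  have h2 : 0 < (4 : ℝ) ^ Γ2 - 1 := by
    have := Real.one_lt_rpow (x := 4) (by norm_num) hΓ2
    linarith
  unfold IsESE IsSE
  generalize (4 : ℝ) ^ Γ1 - 1 = c at *
  generalize (4 : ℝ) ^ Γ2 - 1 = d at *
  -- the linear system has at most one solution when its determinant is nonzero
  have key : c * a21 * (d * a12) < 1 → ∀ p1 p2 q1 q2 : ℝ,
      p1 = c * (a21 * p2 + I1) → p2 = d * (a12 * p1 + I2) →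
      q1 = c * (a21 * q2 + I1) → q2 = d * (a12 * q1 + I2) → p1 = q1 ∧ p2 = q2 := by
    intro hk p1 p2 q1 q2 e1 e2 e3 e4
    have h : (1 - c * a21 * (d * a12)) * (p1 - q1) = 0 := by
      linear_combination e1 - e3 + c * a21 * (e2 - e4)
    have hp : p1 = q1 := by
      rcases mul_eq_zero.mp h with h | h <;> linarith
    exact ⟨hp, by rw [e2, e4, hp]⟩
  have tight : ∀ p1 p2 : ℝ, ((0 ≤ p1 ∧ 0 ≤ p2 ∧ p1 ≥ c * (a21 * p2 + I1) ∧
      p2 ≥ d * (a12 * p1 + I2)) ∧ (∀ q1 : ℝ, q1 ≥ c * (a21 * p2 + I1) → p1 ≤ q1) ∧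
      (∀ q2 : ℝ, q2 ≥ d * (a12 * p1 + I2) → p2 ≤ q2)) →
      p1 = c * (a21 * p2 + I1) ∧ p2 = d * (a12 * p1 + I2) := by
    rintro p1 p2 ⟨⟨_, _, g1, g2⟩, m1, m2⟩
    exact ⟨le_antisymm (m1 _ le_rfl) g1, le_antisymm (m2 _ le_rfl) g2⟩
  refine ⟨?_, tight, ?_⟩
  · intro p1 p2 q1 q2 hp hq
    obtain ⟨e1, e2⟩ := tight _ _ hp
    obtain ⟨e3, e4⟩ := tight _ _ hq
    have hp1 : 0 ≤ p1 := hp.1.1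
    refine key ?_ p1 p2 q1 q2 e1 e2 e3 e4
    -- existence of a nonnegative solution forces the determinant to be positive
    by_contra hk
    have hpos : 0 < c * a21 * (d * I2) + c * I1 := by positivity
    have h : (1 - c * a21 * (d * a12)) * p1 = c * a21 * (d * I2) + c * I1 := by
      linear_combination e1 + c * a21 * e2
    have := mul_nonneg (sub_nonneg.mpr (not_lt.mp hk)) hp1
    linarith
  · intro hlt
    refine key ?_
    rw [lt_div_iff₀ (mul_pos h1 h2)] at hlt
    linarith
end

section
/- Assume a21·a12 < 1/((4^Γ1 − 1)·(4^Γ2 − 1)) and let (p1*, p2*) be the efficient satisfaction equilibrium given by p1* = (4^Γ1 − 1)·(a21·(4^Γ2 − 1)·I2 + I1)/D and p2* = (4^Γ2 − 1)·(a12·(4^Γ1 − 1)·I1 + I2)/D with D = 1 − (4^Γ1 − 1)·(4^Γ2 − 1)·a21·a12. Then for every satisfaction equilibrium (p1,p2) one has p1* ≤ p1 and p2* ≤ p2; in particular (p1*,p2*) minimizes the sum p1 + p2 over all satisfaction equilibria. -/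
/-- Under `a21·a12 < 1/((4^Γ1 − 1)·(4^Γ2 − 1))`, the efficient satisfaction
equilibrium `(p1*,p2*)` given by the closed-form formulas is componentwise
below every satisfaction equilibrium; in particular it minimizes the sum
`p1 + p2` over all satisfaction equilibria. -/
theorem ese_componentwise_min
    (a21 a12 I1 I2 Γ1 Γ2 D p1s p2s : ℝ)
    (ha21 : 0 < a21) (ha12 : 0 < a12) (hI1 : 0 < I1) (hI2 : 0 < I2)
    (hΓ1 : 0 < Γ1) (hΓ2 : 0 < Γ2)
    (hslope : a21 * a12 < 1 / (((4 : ℝ) ^ Γ1 - 1) * ((4 : ℝ) ^ Γ2 - 1)))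
    (hD : D = 1 - ((4 : ℝ) ^ Γ1 - 1) * ((4 : ℝ) ^ Γ2 - 1) * a21 * a12)
    (hp1s : p1s = ((4 : ℝ) ^ Γ1 - 1) * (a21 * ((4 : ℝ) ^ Γ2 - 1) * I2 + I1) / D)
    (hp2s : p2s = ((4 : ℝ) ^ Γ2 - 1) * (a12 * ((4 : ℝ) ^ Γ1 - 1) * I1 + I2) / D) :
    ∀ p1 p2 : ℝ, 0 ≤ p1 → 0 ≤ p2 →
      p1 ≥ ((4 : ℝ) ^ Γ1 - 1) * (a21 * p2 + I1) →
      p2 ≥ ((4 : ℝ) ^ Γ2 - 1) * (a12 * p1 + I2) →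
      (p1s ≤ p1 ∧ p2s ≤ p2) ∧ p1s + p2s ≤ p1 + p2 := by
  have hA : 0 < (4 : ℝ) ^ Γ1 - 1 := sub_pos.2 (Real.one_lt_rpow (by norm_num) hΓ1)
  have hB : 0 < (4 : ℝ) ^ Γ2 - 1 := sub_pos.2 (Real.one_lt_rpow (by norm_num) hΓ2)
  generalize (4 : ℝ) ^ Γ1 - 1 = A at *
  generalize (4 : ℝ) ^ Γ2 - 1 = B at *
  rw [lt_div_iff₀ (mul_pos hA hB)] at hslope
  have hD0 : 0 < D := by rw [hD]; linarith
  intro p1 p2 _ _ h1 h2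
  have e1 : p1s ≤ p1 := by
    rw [hp1s, div_le_iff₀ hD0, hD]
    have := mul_le_mul_of_nonneg_left h2 (mul_pos hA ha21).le
    linarith
  have e2 : p2s ≤ p2 := by
    rw [hp2s, div_le_iff₀ hD0, hD]
    have := mul_le_mul_of_nonneg_left h1 (mul_pos hB ha12).le
    linarith
  exact ⟨⟨e1, e2⟩, add_le_add e1 e2⟩
end
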